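/- arXiv:math/0405383 — 3 statements merged into one kernel-verified Lean document; each statement's English description precedes it below -/
import Mathlib

section
/- Suppose the parameters are conjugation-invariant, i.e. k_j = k_{j'} whenever j ≡ j' + 2 (mod d). Then the two Dunkl operators commute: D_Z(D_W(f)) = D_W(D_Z(f)) for every f ∈ ℂ[Z,W]. -/
open MvPolynomial
open scoped Classical

noncomputable section

/-- The polynomial ring `ℂ[Z,W]`, with `Z = X 0` and `W = X 1`. -/
abbrev R2 : Type := MvPolynomial (Fin 2) ℂ

/-- `ζ = exp(2πi/d)`. -/
def zeta (d : ℕ) : ℂ := Complex.exp (2 * Real.pi * Complex.I / d)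

/-- The action of the reflection `s_j` of `I₂(d)` on `ℂ[Z,W]`:
`Z ↦ ζ^j·W`, `W ↦ ζ^{-j}·Z`. -/
def reflAct (d j : ℕ) : R2 →ₐ[ℂ] R2 :=
  aeval ![C (zeta d ^ j) * X 1, C ((zeta d ^ j)⁻¹) * X 0]

/-- Exact division: if `a ∣ b` in `ℂ[Z,W]` this is the (unique, when `a ≠ 0`)
quotient, and `0` otherwise. -/
def exQuot (a b : R2) : R2 := if h : ∃ c, b = a * c then Classical.choose h else 0

/-- The Dunkl operator `D_Z` with parameters `k₁,…,k_d`. -/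
def DZ (d : ℕ) (k : ℕ → ℂ) (f : R2) : R2 :=
  pderiv (0 : Fin 2) f - ∑ j ∈ Finset.Icc 1 d,
    C (k j) * exQuot (X 0 - C (zeta d ^ j) * X 1) (f - reflAct d j f)

/-- The Dunkl operator `D_W` with parameters `k₁,…,k_d`. -/
def DW (d : ℕ) (k : ℕ → ℂ) (f : R2) : R2 :=
  pderiv (1 : Fin 2) f - ∑ j ∈ Finset.Icc 1 d,
    C (k j) * exQuot (X 1 - C ((zeta d ^ j)⁻¹) * X 0) (f - reflAct d j f)

/-! ### The reflections, their linear forms and divided differences -/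

/-- The reflection `Z ↦ c·W`, `W ↦ c⁻¹·Z`. -/
def reflHom (c : ℂˣ) : R2 →ₐ[ℂ] R2 :=
  aeval ![C (c : ℂ) * X 1, C ((c : ℂ)⁻¹) * X 0]

/-- The linear form `Z - c·W` vanishing on the mirror of `reflHom c`. -/
def mirrorForm (c : ℂ) : R2 := X 0 - C c * X 1

lemma reflHom_X_zero (c : ℂˣ) : reflHom c (X 0) = C (c : ℂ) * X 1 := by simp [reflHom]

lemma reflHom_X_one (c : ℂˣ) : reflHom c (X 1) = C ((c : ℂ)⁻¹) * X 0 := by simp [reflHom]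

lemma reflHom_C (c : ℂˣ) (a : ℂ) : reflHom c (C a) = C a := by simp [reflHom, algebraMap_eq]

lemma mirrorForm_ne_zero (c : ℂ) : mirrorForm c ≠ 0 := by
  intro h
  have := congrArg (eval ![1, 0]) h
  simp [mirrorForm] at this

lemma mirrorForm_dvd (c : ℂˣ) (f : R2) : mirrorForm c ∣ f - reflHom c f := by
  have key : (Ideal.Quotient.mkₐ ℂ (Ideal.span {mirrorForm (c : ℂ)})) =
      (Ideal.Quotient.mkₐ ℂ (Ideal.span {mirrorForm (c : ℂ)})).comp (reflHom c) := by
    apply MvPolynomial.algHom_ext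
    intro i
    simp only [AlgHom.comp_apply, Ideal.Quotient.mkₐ_eq_mk]
    rw [Ideal.Quotient.eq, Ideal.mem_span_singleton]
    fin_cases i
    · simp [reflHom_X_zero, mirrorForm]
    · refine ⟨C (-(c : ℂ)⁻¹), ?_⟩
      have h : (C (c : ℂ) * C ((c : ℂ)⁻¹) : R2) = 1 := by
        rw [← C_mul, mul_inv_cancel₀ c.ne_zero, C_1]
      simp only [Fin.mk_one, reflHom_X_one, mirrorForm, C_neg]
      linear_combination (-X 1) * h
  have h := DFunLike.congr_fun key f
  simp only [AlgHom.comp_apply, Ideal.Quotient.mkₐ_eq_mk] at h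
  rwa [Ideal.Quotient.eq, Ideal.mem_span_singleton] at h

lemma mul_exQuot {a b : R2} (h : a ∣ b) : a * exQuot a b = b := by
  have h' : ∃ c, b = a * c := h
  rw [exQuot, dif_pos h']
  exact (Classical.choose_spec h').symm

/-- The divided difference `f ↦ (f - reflHom c f) / (Z - c·W)`. -/
def divDiff (c : ℂˣ) : R2 →ₗ[ℂ] R2 where
  toFun f := exQuot (mirrorForm c) (f - reflHom c f)
  map_add' f g := by
    apply mul_left_cancel₀ (mirrorForm_ne_zero c)
    rw [mul_add, mul_exQuot (mirrorForm_dvd c _), mul_exQuot (mirrorForm_dvd c _),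
      mul_exQuot (mirrorForm_dvd c _), map_add]
    ring
  map_smul' a f := by
    apply mul_left_cancel₀ (mirrorForm_ne_zero c)
    rw [RingHom.id_apply, mul_smul_comm, mul_exQuot (mirrorForm_dvd c _),
      mul_exQuot (mirrorForm_dvd c _), map_smul, smul_sub]

lemma mirrorForm_mul_divDiff (c : ℂˣ) (f : R2) :
    mirrorForm c * divDiff c f = f - reflHom c f :=
  mul_exQuot (mirrorForm_dvd c f)

lemma exQuot_swap (c : ℂˣ) (f : R2) :
    exQuot (X 1 - C ((c : ℂ)⁻¹) * X 0) (f - reflHom c f) = -((c : ℂ) • divDiff c f) := by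
  have h : (C (c : ℂ) * C ((c : ℂ)⁻¹) : R2) = 1 := by
    rw [← C_mul, mul_inv_cancel₀ c.ne_zero, C_1]
  have hform : mirrorForm c = (X 1 - C ((c : ℂ)⁻¹) * X 0) * -C (c : ℂ) := by
    rw [mirrorForm]
    linear_combination (-X 0) * h
  have hne : (X 1 - C ((c : ℂ)⁻¹) * X 0 : R2) ≠ 0 := by
    intro h0
    exact mirrorForm_ne_zero c (by rw [hform, h0, zero_mul])
  apply mul_left_cancel₀ hne
  rw [mul_exQuot ((Dvd.intro _ hform.symm).trans (mirrorForm_dvd c f)),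
    ← mirrorForm_mul_divDiff c f, hform, smul_eq_C_mul]
  ring

/-! ### The tangential derivative commutes with the divided difference -/

/-- The derivative along the mirror of `reflHom c`. -/
def mirrorDeriv (c : ℂ) : Derivation ℂ R2 R2 := c • pderiv 0 + pderiv 1

lemma mirrorDeriv_apply (c : ℂ) (f : R2) :
    mirrorDeriv c f = c • pderiv 0 f + pderiv 1 f := rfl

lemma mirrorDeriv_mirrorForm (c : ℂ) : mirrorDeriv c (mirrorForm c) = 0 := by
  simp [mirrorDeriv_apply, mirrorForm, pderiv_X, smul_eq_C_mul]

lemma mirrorDeriv_reflHom (c : ℂˣ) (f : R2) :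
    mirrorDeriv c (reflHom c f) = reflHom c (mirrorDeriv c f) := by
  have h : (C ((c : ℂ)⁻¹) * C (c : ℂ) : R2) = 1 := by
    rw [← C_mul, inv_mul_cancel₀ c.ne_zero, C_1]
  induction f using MvPolynomial.induction_on with
  | C a =>
    rw [reflHom_C, ← algebraMap_eq, Derivation.map_algebraMap, map_zero]
  | add p q hp hq => simp only [map_add, hp, hq]
  | mul_X p i hp =>
    have hX : mirrorDeriv c (reflHom c (X i)) = reflHom c (mirrorDeriv c (X i)) := by
      fin_cases i
      · simp [mirrorDeriv_apply, reflHom_X_zero, pderiv_X, smul_eq_C_mul]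
      · simp [mirrorDeriv_apply, reflHom_X_one, pderiv_X, smul_eq_C_mul, h]
    simp only [map_mul, Derivation.leibniz, map_add, smul_eq_mul, hp, hX]

lemma mirrorDeriv_divDiff (c : ℂˣ) (f : R2) :
    mirrorDeriv c (divDiff c f) = divDiff c (mirrorDeriv c f) := by
  apply mul_left_cancel₀ (mirrorForm_ne_zero c)
  have h := congrArg (mirrorDeriv c) (mirrorForm_mul_divDiff c f)
  rw [Derivation.leibniz, mirrorDeriv_mirrorForm, smul_zero, add_zero, smul_eq_mul, map_sub,
    mirrorDeriv_reflHom] at h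
  rw [h, mirrorForm_mul_divDiff]

/-! ### Compositions of divided differences -/

lemma reflHom_mirrorForm (b c : ℂˣ) :
    reflHom b (mirrorForm c) = -C ((c / b : ℂˣ) : ℂ) * mirrorForm ((b * b / c : ℂˣ) : ℂ) := by
  have h : (C ((c / b : ℂˣ) : ℂ) * C ((b * b / c : ℂˣ) : ℂ) : R2) = C (b : ℂ) := by
    rw [← C_mul, ← Units.val_mul]
    congr 2
    rw [div_mul_div_comm, mul_comm c, mul_assoc b b c, mul_div_cancel_right]
  have h' : (C (c : ℂ) * C ((b : ℂ)⁻¹) : R2) = C ((c / b : ℂˣ) : ℂ) := by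
    rw [← C_mul]
    simp [div_eq_mul_inv]
  simp only [mirrorForm, map_sub, map_mul, reflHom_X_zero, reflHom_X_one, reflHom_C]
  linear_combination (-X 1) * h - X 0 * h'

lemma reflHom_reflHom (b c : ℂˣ) (f : R2) :
    reflHom b (reflHom c f) =
      aeval ![C ((c / b : ℂˣ) : ℂ) * X 0, C ((b / c : ℂˣ) : ℂ) * X 1] f := by
  rw [← AlgHom.comp_apply]
  congr 1
  apply MvPolynomial.algHom_ext
  intro i
  fin_cases i
  · simp [reflHom_X_zero, reflHom_X_one, div_eq_mul_inv, mul_assoc]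
  · simp [reflHom_X_zero, reflHom_X_one, div_eq_mul_inv, mul_assoc, mul_left_comm]

/-- The composition of two divided differences, in a field containing `ℂ[Z,W]`. -/
lemma map_divDiff_divDiff {K : Type*} [Field K] {φ : R2 →+* K} (hφ : Function.Injective φ)
    (b c : ℂˣ) (f : R2) :
    φ (divDiff b (divDiff c f)) =
      ((φ f - φ (reflHom c f)) / φ (mirrorForm c) -
        (φ (reflHom b f) - φ (reflHom b (reflHom c f))) /
          (-φ (C ((c / b : ℂˣ) : ℂ)) * φ (mirrorForm ((b * b / c : ℂˣ) : ℂ)))) /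
        φ (mirrorForm b) := by
  have hform (a : ℂ) : φ (mirrorForm a) ≠ 0 := (map_ne_zero_iff φ hφ).mpr (mirrorForm_ne_zero a)
  have hC : φ (C ((c / b : ℂˣ) : ℂ)) ≠ 0 :=
    (map_ne_zero_iff φ hφ).mpr (C_ne_zero.mpr (Units.ne_zero _))
  have h₁ := congrArg φ (mirrorForm_mul_divDiff c f)
  have h₂ := congrArg φ (mirrorForm_mul_divDiff b (divDiff c f))
  have h₃ := congrArg (fun x => φ (reflHom b x)) (mirrorForm_mul_divDiff c f)
  simp only [map_mul, map_sub, map_neg, reflHom_mirrorForm] at h₁ h₂ h₃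
  rw [← h₁, ← h₃, mul_div_cancel_left₀ _ (hform _),
    mul_div_cancel_left₀ _ (mul_ne_zero (neg_ne_zero.mpr hC) (hform _)), ← h₂,
    mul_div_cancel_left₀ _ (hform _)]

/-! ### The quadratic relation -/

section QuadraticRelation

variable {d : ℕ} [NeZero d]

lemma eq_add_two_mul {α : Type*} {k : ZMod d → α} (hk : ∀ i, k (i + 2) = k i) (x y : ZMod d) :
    k (x + 2 * y) = k x := by
  have key : ∀ n : ℕ, k (x + 2 * (n : ZMod d)) = k x := by
    intro n
    induction n with
    | zero => simp
    | succ n ih => rw [← ih, ← hk (x + 2 * (n : ZMod d))]; congr 1; push_cast; ring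
  simpa using key y.val

/-- The vanishing of the quadratic part of the commutator, in a field of fractions: the value
`g` of the function, its reflections `s i` and its rotations `p r` each have coefficient zero. -/
lemma sum_divDiff_coeff_eq_zero {K : Type*} [Field K] [CharZero K]
    {k z s p : ZMod d → K} {Z W g : K}
    (hk : ∀ i, k (i + 2) = k i) (hz : ∀ i, z i ≠ 0) (hzz : ∀ i j, z (i + j) = z i * z j)
    (hW : W ≠ 0) (ha : ∀ i, Z - z i * W ≠ 0) :
    ∑ i, ∑ j, k i * k j * (z j - z i) *
      (((g - s j) / (Z - z j * W) -
        (s i - p (j - i)) / (-z (j - i) * (Z - z (2 * i - j) * W))) / (Z - z i * W)) = 0 := by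
  set B : ZMod d → ZMod d → K := fun i j =>
    k i * k j * (z j - z i) / ((Z - z i * W) * (Z - z j * W)) with hB
  have hanti : ∀ i j, B i j = -B j i := fun i j => by
    simp only [hB]; rw [mul_comm (Z - z j * W)]; ring
  have hkr : ∀ i j, k (2 * i - j) = k j := fun i j => by
    rw [← eq_add_two_mul hk j (i - j)]; congr 1; ring
  have hterm : ∀ i j, k i * k j * (z j - z i) *
      (((g - s j) / (Z - z j * W) -
        (s i - p (j - i)) / (-z (j - i) * (Z - z (2 * i - j) * W))) / (Z - z i * W)) =
      B i j * g - B i j * s j - B i (2 * i - j) * s i + B i (2 * i - j) * p (j - i) := by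
    intro i j
    have h1 := ha i
    have h2 := ha j
    have h3 := ha (2 * i - j)
    have h4 := hz (j - i)
    have e1 : z j = z (j - i) * z i := by rw [← hzz]; congr 1; ring
    have e2 : z i = z (j - i) * z (2 * i - j) := by rw [← hzz]; congr 1; ring
    have e3 : (z j - z i) / (-z (j - i) * (Z - z (2 * i - j) * W)) =
        (z (2 * i - j) - z i) / (Z - z (2 * i - j) * W) := by
      rw [div_eq_div_iff (mul_ne_zero (neg_ne_zero.mpr h4) h3) h3]
      linear_combination (Z - z (2 * i - j) * W) * (e1 - e2)
    have e4 : B i (2 * i - j) = k i * k j *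
        ((z j - z i) / (-z (j - i) * (Z - z (2 * i - j) * W))) / (Z - z i * W) := by
      rw [e3]; simp only [hB, hkr]; field_simp
    rw [e4]; simp only [hB]; field_simp; ring
  have hBsplit : ∀ i j, B i j = W⁻¹ * (k i * k j / (Z - z j * W) - k i * k j / (Z - z i * W)) := by
    intro i j
    have h1 := ha i
    have h2 := ha j
    simp only [hB]; field_simp; ring
  have hg : ∑ i, ∑ j, B i j = 0 := by
    have h : ∑ i, ∑ j, B i j = -∑ i, ∑ j, B i j := by
      conv_lhs => rw [Finset.sum_comm]
      simp only [← Finset.sum_neg_distrib]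
      exact Finset.sum_congr rfl fun i _ => Finset.sum_congr rfl fun j _ => hanti j i
    exact self_eq_neg.mp h
  have hs : ∑ i, ∑ j, B i (2 * i - j) * s i = -∑ i, ∑ j, B i j * s j := by
    have h : ∀ i, ∑ j, B i (2 * i - j) * s i = ∑ j, B i j * s i := fun i =>
      (Equiv.subLeft (2 * i)).sum_comp fun j => B i j * s i
    simp only [h]
    rw [Finset.sum_comm]
    simp only [← Finset.sum_neg_distrib]
    exact Finset.sum_congr rfl fun i _ => Finset.sum_congr rfl fun j _ => by
      rw [hanti j i, neg_mul]
  have hp : ∑ i, ∑ j, B i (2 * i - j) * p (j - i) = 0 := by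
    have h : ∀ i, ∑ j, B i (2 * i - j) * p (j - i) = ∑ r, B i (i - r) * p r := fun i => by
      rw [← Equiv.sum_comp (Equiv.addRight i)]
      refine Finset.sum_congr rfl fun r _ => ?_
      simp only [Equiv.coe_addRight, add_sub_cancel_right]
      congr 2; ring
    simp only [h]
    rw [Finset.sum_comm]
    refine Finset.sum_eq_zero fun r _ => ?_
    rw [← Finset.sum_mul]
    simp only [hBsplit, ← Finset.mul_sum, Finset.sum_sub_distrib]
    have hshift : ∑ i, k i * k (i - r) / (Z - z (i - r) * W) =
        ∑ i, k i * k (i - r) / (Z - z i * W) := by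
      rw [← Equiv.sum_comp (Equiv.addRight r)]
      refine Finset.sum_congr rfl fun i _ => ?_
      simp only [Equiv.coe_addRight, add_sub_cancel_right]
      rw [show i + r = (i - r) + 2 * r by ring, eq_add_two_mul hk, mul_comm (k i)]
    rw [hshift, sub_self, mul_zero, zero_mul]
  simp only [hterm, Finset.sum_add_distrib, Finset.sum_sub_distrib, ← Finset.sum_mul, hg, hp]
  simp only [Finset.sum_mul, hs]
  ring

lemma sum_smul_divDiff_divDiff_eq_zero {k : ZMod d → ℂ} {z : ZMod d → ℂˣ}
    (hk : ∀ i, k (i + 2) = k i) (hz : ∀ i j, z (i + j) = z i * z j) (f : R2) :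
    ∑ i, ∑ j, (k i * k j * ((z j : ℂ) - z i)) • divDiff (z i) (divDiff (z j) f) = 0 := by
  have hsub : ∀ i j, z (i - j) = z i / z j := fun i j => by
    rw [eq_div_iff_mul_eq', ← hz, sub_add_cancel]
  obtain ⟨K, _, _, φ, hφ⟩ : ∃ (K : Type) (_ : Field K) (_ : CharZero K) (φ : R2 →+* K),
      Function.Injective φ :=
    ⟨FractionRing R2, inferInstance, inferInstance, algebraMap _ _, IsFractionRing.injective _ _⟩
  have hφ0 {x : R2} (h : x ≠ 0) : φ x ≠ 0 := (map_ne_zero_iff φ hφ).mpr h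
  have hform (c : ℂ) : φ (X 0) - φ (C c) * φ (X 1) = φ (mirrorForm c) := by simp [mirrorForm]
  let ρ : ZMod d → R2 := fun r => aeval ![C (z r : ℂ) * X 0, C (z (-r) : ℂ) * X 1] f
  have hρ (i j : ZMod d) : reflHom (z i) (reflHom (z j) f) = ρ (j - i) := by
    simp only [reflHom_reflHom, ρ, neg_sub, hsub]
  have key := sum_divDiff_coeff_eq_zero (k := fun i => φ (C (k i)))
    (z := fun i => φ (C (z i : ℂ))) (s := fun i => φ (reflHom (z i) f)) (p := fun r => φ (ρ r))
    (Z := φ (X 0)) (W := φ (X 1)) (g := φ f) (fun i => by simp only [hk])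
    (fun i => hφ0 (C_ne_zero.mpr (Units.ne_zero _)))
    (fun i j => by simp only [hz, Units.val_mul, map_mul])
    (hφ0 (X_ne_zero 1)) (fun i => by rw [hform]; exact hφ0 (mirrorForm_ne_zero _))
  apply hφ
  rw [map_zero, ← key]
  simp only [map_sum, smul_eq_C_mul, map_mul, map_sub, map_divDiff_divDiff hφ, hform, hρ, hsub,
    two_mul, hz]

/-! ### Commutation -/

lemma pderiv_zero_pderiv_one (f : R2) :
    pderiv (0 : Fin 2) (pderiv (1 : Fin 2) f) = pderiv 1 (pderiv 0 f) := by
  have h : ⁅(pderiv 0 : Derivation ℂ R2 R2), (pderiv 1 : Derivation ℂ R2 R2)⁆ = 0 := by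
    apply MvPolynomial.derivation_ext
    intro i
    fin_cases i <;> simp [Derivation.commutator_apply, pderiv_X]
  have h' := DFunLike.congr_fun h f
  rwa [Derivation.commutator_apply, Derivation.zero_apply, sub_eq_zero] at h'

/-- The Dunkl operator `D_Z`, with the reflections indexed by `ZMod d`. -/
def dunklZ (k : ZMod d → ℂ) (z : ZMod d → ℂˣ) (f : R2) : R2 :=
  pderiv 0 f - ∑ i, k i • divDiff (z i) f

/-- The Dunkl operator `D_W`, with the reflections indexed by `ZMod d`. -/
def dunklW (k : ZMod d → ℂ) (z : ZMod d → ℂˣ) (f : R2) : R2 :=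
  pderiv 1 f + ∑ i, (k i * z i) • divDiff (z i) f

lemma dunklZ_dunklW_comm {k : ZMod d → ℂ} {z : ZMod d → ℂˣ}
    (hk : ∀ i, k (i + 2) = k i) (hz : ∀ i j, z (i + j) = z i * z j) (f : R2) :
    dunklZ k z (dunklW k z f) = dunklW k z (dunklZ k z f) := by
  have hquad := sum_smul_divDiff_divDiff_eq_zero hk hz f
  simp only [mul_sub, sub_smul, Finset.sum_sub_distrib] at hquad
  have hlin : ∑ i, ((k i * z i) • pderiv 0 (divDiff (z i) f) + k i • pderiv 1 (divDiff (z i) f)) =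
      ∑ i, ((k i * z i) • divDiff (z i) (pderiv 0 f) + k i • divDiff (z i) (pderiv 1 f)) := by
    refine Finset.sum_congr rfl fun i _ => ?_
    have h := congrArg (k i • ·) (mirrorDeriv_divDiff (z i) f)
    simpa only [mirrorDeriv_apply, map_add, map_smul, smul_add, smul_smul] using h
  have hder : pderiv 0 (pderiv 1 f) = pderiv 1 (pderiv 0 f) := pderiv_zero_pderiv_one f
  simp only [Finset.sum_add_distrib] at hlin
  simp only [dunklZ, dunklW, map_add, map_sub, map_sum, map_smul, smul_add, smul_sub,
    Finset.smul_sum, smul_smul, Finset.sum_add_distrib, Finset.sum_sub_distrib, hder,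
    Derivation.map_smul]
  have e1 : ∀ i j, k i * (k j * (z j : ℂ)) = k i * k j * z j := fun i j => by ring
  have e2 : ∀ i j, k i * (z i : ℂ) * k j = k i * k j * z i := fun i j => by ring
  simp only [e1, e2]
  linear_combination hlin - hquad

end QuadraticRelation

/-! ### Passing from indices in `{1, …, d}` to `ZMod d` -/

lemma zeta_pow_eq {d : ℕ} [NeZero d] {m n : ℕ} (h : (m : ZMod d) = n) :
    zeta d ^ m = zeta d ^ n := by
  have h1 : zeta d ^ d = 1 := (Complex.isPrimitiveRoot_exp d (NeZero.ne d)).pow_eq_one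
  rw [ZMod.natCast_eq_natCast_iff] at h
  exact pow_eq_pow_of_modEq h h1

/-- The representative in `{1, …, d}` of a residue class. -/
def rep {d : ℕ} (i : ZMod d) : ℕ := if i = 0 then d else i.val

lemma cast_rep {d : ℕ} [NeZero d] (i : ZMod d) : (rep i : ZMod d) = i := by
  unfold rep; split_ifs with h <;> simp [h]

lemma rep_mem {d : ℕ} [NeZero d] (i : ZMod d) : rep i ∈ Finset.Icc 1 d := by
  have hd := NeZero.pos d
  unfold rep
  rw [Finset.mem_Icc]
  split_ifs with h
  · omega
  · exact ⟨Nat.pos_of_ne_zero fun h0 => h ((ZMod.val_eq_zero i).mp h0), (ZMod.val_lt i).le⟩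

lemma rep_cast {d : ℕ} [NeZero d] {j : ℕ} (hj : j ∈ Finset.Icc 1 d) : rep (j : ZMod d) = j := by
  rw [Finset.mem_Icc] at hj
  unfold rep
  rcases hj.2.lt_or_eq with h | rfl
  · rw [if_neg, ZMod.val_cast_of_lt h]
    rw [ZMod.natCast_eq_zero_iff]
    exact fun h0 => absurd (Nat.le_of_dvd hj.1 h0) (by omega)
  · simp

lemma sum_Icc_eq_sum_zmod {d : ℕ} [NeZero d] {M : Type*} [AddCommMonoid M] (F : ℕ → M) :
    ∑ j ∈ Finset.Icc 1 d, F j = ∑ i : ZMod d, F (rep i) :=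
  Finset.sum_nbij' (fun j => (j : ZMod d)) rep (fun _ _ => Finset.mem_univ _)
    (fun i _ => rep_mem i) (fun _ hj => rep_cast hj) (fun i _ => cast_rep i)
    (fun _ hj => by rw [rep_cast hj])

/-- The root of unity `ζ^i` for a residue class `i`, as a unit. -/
def zetaUnit {d : ℕ} (i : ZMod d) : ℂˣ :=
  Units.mk0 (zeta d ^ rep i) (pow_ne_zero _ (Complex.exp_ne_zero _))

lemma zetaUnit_add {d : ℕ} [NeZero d] (i j : ZMod d) :
    zetaUnit (i + j) = zetaUnit i * zetaUnit j := by
  ext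
  simp only [zetaUnit, Units.val_mk0, Units.val_mul, ← pow_add]
  exact zeta_pow_eq (by simp [cast_rep])

lemma DZ_eq_dunklZ (d : ℕ) [NeZero d] (k : ℕ → ℂ) (f : R2) :
    DZ d k f = dunklZ (fun i : ZMod d => k (rep i)) zetaUnit f := by
  rw [DZ, dunklZ, sum_Icc_eq_sum_zmod]
  simp only [smul_eq_C_mul]
  rfl

lemma DW_eq_dunklW (d : ℕ) [NeZero d] (k : ℕ → ℂ) (f : R2) :
    DW d k f = dunklW (fun i : ZMod d => k (rep i)) zetaUnit f := by
  rw [DW, dunklW, sum_Icc_eq_sum_zmod, sub_eq_add_neg, ← Finset.sum_neg_distrib]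
  congr 1
  refine Finset.sum_congr rfl fun i _ => ?_
  have h := exQuot_swap (zetaUnit i) f
  have h' : exQuot (X 1 - C ((zeta d ^ rep i)⁻¹) * X 0) (f - reflAct d (rep i) f) =
      -((zetaUnit i : ℂ) • divDiff (zetaUnit i) f) := h
  rw [h', ← smul_eq_C_mul, smul_neg, neg_neg, smul_smul]

/-- If the parameters are conjugation invariant (`k_j = k_{j'}` whenever
`j ≡ j' + 2 (mod d)`), then the Dunkl operators commute. -/
theorem dunkl_commute (d : ℕ) (hd : 3 ≤ d) (k : ℕ → ℂ)
    (hk : ∀ j j', j ∈ Finset.Icc 1 d → j' ∈ Finset.Icc 1 d →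
      (j : ZMod d) = (j' : ZMod d) + 2 → k j = k j')
    (f : R2) :
    DZ d k (DW d k f) = DW d k (DZ d k f) := by
  have : NeZero d := ⟨by omega⟩
  simp only [DZ_eq_dunklZ, DW_eq_dunklW]
  exact dunklZ_dunklW_comm
    (fun i => hk _ _ (rep_mem _) (rep_mem _) (by simp only [cast_rep])) zetaUnit_add f

end
end

section
/- For every f ∈ ℂ[Z,W] the Dunkl operators satisfy the defining commutation relations of the rational Cherednik algebra of I₂(d): D_Z(Z·f) = Z·D_Z(f) + f − Σ_{j=1}^d k_j·σ_j(f), D_Z(W·f) = W·D_Z(f) + Σ_{j=1}^d k_j·ζ^{−j}·σ_j(f), D_W(W·f) = W·D_W(f) + f − Σ_{j=1}^d k_j·σ_j(f), and D_W(Z·f) = Z·D_W(f) + Σ_{j=1}^d k_j·ζ^{j}·σ_j(f). -/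
open MvPolynomial
open scoped Classical

noncomputable section

theorem zeta_pow_ne_zero (d j : ℕ) : zeta d ^ j ≠ 0 :=
  pow_ne_zero _ (Complex.exp_ne_zero _)

theorem reflAct_X_zero (d j : ℕ) : reflAct d j (X 0) = C (zeta d ^ j) * X 1 := by
  simp [reflAct]

theorem reflAct_X_one (d j : ℕ) : reflAct d j (X 1) = C ((zeta d ^ j)⁻¹) * X 0 := by
  simp [reflAct]

theorem C_mul_C_inv {c : ℂ} (hc : c ≠ 0) : (C c * C c⁻¹ : R2) = 1 := by
  rw [← C_mul, mul_inv_cancel₀ hc, C_1]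

theorem X_sub_C_mul_X_ne_zero {i j : Fin 2} (hij : i ≠ j) (c : ℂ) :
    (X i - C c * X j : R2) ≠ 0 := by
  intro h
  have := congrArg (eval (Pi.single i (1 : ℂ))) h
  simp [hij.symm] at this

theorem exQuot_eq_of_eq_mul {a b c : R2} (ha : a ≠ 0) (h : b = a * c) : exQuot a b = c := by
  have hex : ∃ c, b = a * c := ⟨c, h⟩
  rw [exQuot, dif_pos hex]
  exact mul_left_cancel₀ ha ((Classical.choose_spec hex).symm.trans h)

/-- An algebra endomorphism that is trivial on the variables modulo `a` is trivial modulo `a`. -/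
theorem dvd_sub_algHom_of_dvd_X_sub {a : R2} (φ : R2 →ₐ[ℂ] R2)
    (h : ∀ i, a ∣ X i - φ (X i)) (f : R2) : a ∣ f - φ f := by
  induction f using MvPolynomial.induction_on with
  | C c => simp [← algebraMap_eq]
  | add p q hp hq =>
    rw [map_add, add_sub_add_comm]
    exact dvd_add hp hq
  | mul_X p i hp =>
    have : p * X i - φ (p * X i) = (p - φ p) * X i + φ p * (X i - φ (X i)) := by
      rw [map_mul]; ring
    rw [this]
    exact dvd_add (hp.mul_right _) ((h i).mul_left _)

theorem dvd_sub_reflAct_Z (d j : ℕ) (f : R2) :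
    X 0 - C (zeta d ^ j) * X 1 ∣ f - reflAct d j f := by
  refine dvd_sub_algHom_of_dvd_X_sub _ (Fin.forall_fin_two.2 ⟨?_, ?_⟩) f
  · rw [reflAct_X_zero]
  · rw [reflAct_X_one]
    refine ⟨-C ((zeta d ^ j)⁻¹), ?_⟩
    linear_combination -X 1 * C_mul_C_inv (zeta_pow_ne_zero d j)

theorem dvd_sub_reflAct_W (d j : ℕ) (f : R2) :
    X 1 - C ((zeta d ^ j)⁻¹) * X 0 ∣ f - reflAct d j f := by
  refine dvd_sub_algHom_of_dvd_X_sub _ (Fin.forall_fin_two.2 ⟨?_, ?_⟩) f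
  · rw [reflAct_X_zero]
    refine ⟨-C (zeta d ^ j), ?_⟩
    linear_combination -X 0 * C_mul_C_inv (zeta_pow_ne_zero d j)
  · rw [reflAct_X_one]

/-- Twisted Leibniz rule for the divided difference `(f - φ f) / a`. -/
theorem exQuot_mul_sub_algHom {a g r f : R2} (ha : a ≠ 0) (φ : R2 →ₐ[ℂ] R2)
    (hf : a ∣ f - φ f) (hg : g - φ g = a * r) :
    exQuot a (g * f - φ (g * f)) = g * exQuot a (f - φ f) + r * φ f := by
  obtain ⟨q, hq⟩ := hf
  rw [exQuot_eq_of_eq_mul ha hq]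
  apply exQuot_eq_of_eq_mul ha
  rw [map_mul]
  linear_combination g * hq + φ f * hg

/-- Summed form of the twisted Leibniz rule. -/
theorem sum_exQuot_mul_sub_reflAct (d : ℕ) (k : ℕ → ℂ) (a r : ℕ → R2) (g f : R2)
    (ha : ∀ j, a j ≠ 0) (hf : ∀ j, a j ∣ f - reflAct d j f)
    (hg : ∀ j, g - reflAct d j g = a j * r j) :
    ∑ j ∈ Finset.Icc 1 d, C (k j) * exQuot (a j) (g * f - reflAct d j (g * f)) =
      g * ∑ j ∈ Finset.Icc 1 d, C (k j) * exQuot (a j) (f - reflAct d j f) +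
        ∑ j ∈ Finset.Icc 1 d, C (k j) * r j * reflAct d j f := by
  rw [Finset.mul_sum, ← Finset.sum_add_distrib]
  refine Finset.sum_congr rfl fun j _ => ?_
  rw [exQuot_mul_sub_algHom (ha j) _ (hf j) (hg j)]
  ring

/-- The defining commutation relations of the rational Cherednik algebra of the
dihedral group hold for the Dunkl operators acting on `ℂ[Z,W]`. -/
theorem cherednik_relations (d : ℕ) (hd : 3 ≤ d) (k : ℕ → ℂ) (f : R2) :
    DZ d k (X 0 * f) = X 0 * DZ d k f + f
        - ∑ j ∈ Finset.Icc 1 d, C (k j) * reflAct d j f ∧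
    DZ d k (X 1 * f) = X 1 * DZ d k f
        + ∑ j ∈ Finset.Icc 1 d, C (k j * (zeta d ^ j)⁻¹) * reflAct d j f ∧
    DW d k (X 1 * f) = X 1 * DW d k f + f
        - ∑ j ∈ Finset.Icc 1 d, C (k j) * reflAct d j f ∧
    DW d k (X 0 * f) = X 0 * DW d k f
        + ∑ j ∈ Finset.Icc 1 d, C (k j * zeta d ^ j) * reflAct d j f := by
  have hZ := fun j => X_sub_C_mul_X_ne_zero (zero_ne_one (α := Fin 2)) (zeta d ^ j)
  have hW := fun j => X_sub_C_mul_X_ne_zero (one_ne_zero (α := Fin 2)) ((zeta d ^ j)⁻¹)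
  have hζ := fun j => C_mul_C_inv (zeta_pow_ne_zero d j)
  refine ⟨?_, ?_, ?_, ?_⟩
  · rw [DZ, DZ, sum_exQuot_mul_sub_reflAct d k _ (fun _ => 1) (X 0) f hZ
      (fun j => dvd_sub_reflAct_Z d j f) (fun j => by rw [reflAct_X_zero, mul_one])]
    simp only [Derivation.leibniz, pderiv_X_self, smul_eq_mul, mul_one]
    ring
  · rw [DZ, DZ, sum_exQuot_mul_sub_reflAct d k _ (fun j => -C ((zeta d ^ j)⁻¹)) (X 1) f hZ
      (fun j => dvd_sub_reflAct_Z d j f)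
      (fun j => by rw [reflAct_X_one]; linear_combination -X 1 * hζ j)]
    simp only [Derivation.leibniz, pderiv_X_of_ne one_ne_zero, smul_eq_mul, C_mul, mul_neg,
      neg_mul, Finset.sum_neg_distrib]
    ring
  · rw [DW, DW, sum_exQuot_mul_sub_reflAct d k _ (fun _ => 1) (X 1) f hW
      (fun j => dvd_sub_reflAct_W d j f) (fun j => by rw [reflAct_X_one, mul_one])]
    simp only [Derivation.leibniz, pderiv_X_self, smul_eq_mul, mul_one]
    ring
  · rw [DW, DW, sum_exQuot_mul_sub_reflAct d k _ (fun j => -C (zeta d ^ j)) (X 0) f hW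
      (fun j => dvd_sub_reflAct_W d j f)
      (fun j => by rw [reflAct_X_zero]; linear_combination -X 0 * hζ j)]
    simp only [Derivation.leibniz, pderiv_X_of_ne zero_ne_one, smul_eq_mul, C_mul, mul_neg,
      neg_mul, Finset.sum_neg_distrib]
    ring

end
end

section
/- Let d = 2m be even with m ≥ 2, and let k_j = k₁ for odd j and k_j = k₂ for even j. For all integers i, i' ≥ 0, the polynomial f = (Z^m − W^m)^{2i+1}·(Z^m + W^m)^{2i'+1} is singular (i.e. D_Z(f) = 0 and D_W(f) = 0) if and only if k₂ = i + 1/2 and k₁ = i' + 1/2. -/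
open MvPolynomial
open scoped Classical

noncomputable section

theorem exQuot_mul {a : R2} (ha : a ≠ 0) (c : R2) : exQuot a (a * c) = c := by
  have h : ∃ c', a * c = a * c' := ⟨c, rfl⟩
  rw [exQuot, dif_pos h]
  exact (mul_left_cancel₀ ha (Classical.choose_spec h)).symm

theorem derivation_finset_prod {ι A : Type*} [DecidableEq ι] [CommRing A] [Algebra ℂ A]
    (D : Derivation ℂ A A) (s : Finset ι) (l : ι → A) :
    D (∏ t ∈ s, l t) = ∑ t ∈ s, (∏ u ∈ s.erase t, l u) * D (l t) := by
  induction s using Finset.induction_on with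
  | empty => simp
  | insert a s ha ih =>
    rw [Finset.prod_insert ha, Derivation.leibniz, ih, Finset.sum_insert ha,
      Finset.erase_insert ha, smul_eq_mul, smul_eq_mul, Finset.mul_sum, add_comm]
    congr 1
    refine Finset.sum_congr rfl fun t ht => ?_
    have hat : a ≠ t := fun h => ha (h ▸ ht)
    rw [Finset.erase_insert_of_ne hat, Finset.prod_insert (by simp [ha])]
    ring

/-- Dividing a product of linear forms `l t` by the normalized forms `a t = l t / D (l t)` and
summing gives the derivative of the product. -/
theorem sum_exQuot_prod {ι : Type*} [DecidableEq ι] (D : Derivation ℂ R2 R2) (s : Finset ι)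
    (l a : ι → R2) (ha : ∀ t, a t ≠ 0) (hl : ∀ t, l t = a t * D (l t)) (g : R2) :
    ∑ t ∈ s, exQuot (a t) ((∏ u ∈ s, l u) * g) = D (∏ u ∈ s, l u) * g := by
  rw [derivation_finset_prod, Finset.sum_mul]
  refine Finset.sum_congr rfl fun t ht => ?_
  rw [← Finset.mul_prod_erase s l ht, ← exQuot_mul (ha t) ((∏ u ∈ s.erase t, l u) * D (l t) * g)]
  congr 1
  conv_lhs => rw [hl t]
  ring

theorem sum_Icc_one_two_mul {M : Type*} [AddCommMonoid M] (F : ℕ → M) (m : ℕ) :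
    ∑ j ∈ Finset.Icc 1 (2 * m), F j =
      ∑ t ∈ Finset.range m, F (2 * t + 1) + ∑ t ∈ Finset.range m, F (2 * t + 2) := by
  induction m with
  | zero => simp
  | succ n ih =>
    rw [show 2 * (n + 1) = 2 * n + 1 + 1 by ring, Finset.sum_Icc_succ_top (by omega),
      Finset.sum_Icc_succ_top (by omega), ih, Finset.sum_range_succ, Finset.sum_range_succ]
    abel

theorem prod_range_sub_C_mul {m : ℕ} (hm : 0 < m) {ω : ℂ} (hω : IsPrimitiveRoot ω m) (c : ℂ) :
    ∏ t ∈ Finset.range m, ((X 0 : R2) - C (ω ^ t * c) * X 1) =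
      X 0 ^ m - C (c ^ m) * X 1 ^ m := by
  have h := X_pow_sub_C_eq_prod (hω.map_of_injective (C_injective (Fin 2) ℂ)) hm
    (rfl : (C c * X 1 : R2) ^ m = _)
  have h' := congrArg (Polynomial.eval (X 0 : R2)) h
  simp only [Polynomial.eval_sub, Polynomial.eval_pow, Polynomial.eval_X, Polynomial.eval_C,
    Polynomial.eval_prod] at h'
  rw [map_pow, ← mul_pow, h']
  refine Finset.prod_congr rfl fun t _ => ?_
  rw [map_mul, map_pow, mul_assoc]

theorem X_zero_sub_ne_zero (c : ℂ) : (X 0 - C c * X 1 : R2) ≠ 0 := fun h => by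
  simpa using congrArg (eval ![1, 0]) h

theorem X_one_sub_ne_zero (c : ℂ) : (X 1 - C c * X 0 : R2) ≠ 0 := fun h => by
  simpa using congrArg (eval ![0, 1]) h

theorem zeta_ne_zero (d : ℕ) : zeta d ≠ 0 := Complex.exp_ne_zero _

theorem zeta_isPrimitiveRoot {d : ℕ} (hd : d ≠ 0) : IsPrimitiveRoot (zeta d) d :=
  Complex.isPrimitiveRoot_exp d hd

theorem zeta_two_mul_pow {m : ℕ} (hm : 0 < m) : zeta (2 * m) ^ m = -1 :=
  ((zeta_isPrimitiveRoot (by omega)).pow (by omega) (mul_comm 2 m)).eq_neg_one_of_two_right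

/-- The product of the linear forms attached to the reflections of odd index. -/
theorem prod_odd_forms {m : ℕ} (hm : 0 < m) :
    ∏ t ∈ Finset.range m, ((X 0 : R2) - C (zeta (2 * m) ^ (2 * t + 1)) * X 1) =
      X 0 ^ m + X 1 ^ m := by
  have hω := (zeta_isPrimitiveRoot (d := 2 * m) (by omega)).pow (by omega) rfl
  have h := prod_range_sub_C_mul hm hω (zeta (2 * m))
  simp only [← pow_mul, ← pow_succ, zeta_two_mul_pow hm] at h
  simpa using h

/-- The product of the linear forms attached to the reflections of even index. -/
theorem prod_even_forms {m : ℕ} (hm : 0 < m) :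
    ∏ t ∈ Finset.range m, ((X 0 : R2) - C (zeta (2 * m) ^ (2 * t + 2)) * X 1) =
      X 0 ^ m - X 1 ^ m := by
  have hω := (zeta_isPrimitiveRoot (d := 2 * m) (by omega)).pow (by omega) rfl
  have h := prod_range_sub_C_mul hm hω (zeta (2 * m) ^ 2)
  rw [pow_right_comm, zeta_two_mul_pow hm] at h
  simp only [← pow_mul, ← pow_add] at h
  simpa using h

/-- Every reflection negates a product of odd powers of the two discriminant factors. -/
theorem reflAct_odd_pow_mul_odd_pow {m : ℕ} (hm : 0 < m) (i i' j : ℕ) :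
    reflAct (2 * m) j (((X 0 : R2) ^ m - X 1 ^ m) ^ (2 * i + 1) *
        ((X 0 : R2) ^ m + X 1 ^ m) ^ (2 * i' + 1)) =
      -(((X 0 : R2) ^ m - X 1 ^ m) ^ (2 * i + 1) *
        ((X 0 : R2) ^ m + X 1 ^ m) ^ (2 * i' + 1)) := by
  have h0 : reflAct (2 * m) j (X 0) ^ m = (-1) ^ j * X 1 ^ m := by
    simp only [reflAct, aeval_X, Matrix.cons_val_zero, mul_pow, ← map_pow]
    rw [pow_right_comm, zeta_two_mul_pow hm]
    simp
  have h1 : reflAct (2 * m) j (X 1) ^ m = (-1) ^ j * X 0 ^ m := by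
    simp only [reflAct, aeval_X, Matrix.cons_val_one, Matrix.cons_val_fin_one, mul_pow,
      ← map_pow, inv_pow]
    rw [pow_right_comm, zeta_two_mul_pow hm, ← inv_pow, inv_neg_one]
    simp
  simp only [map_mul, map_pow, map_sub, map_add, h0, h1]
  rcases Nat.even_or_odd j with hj | hj
  · simp only [hj.neg_one_pow, one_mul]
    rw [← neg_sub, Odd.neg_pow ⟨i, rfl⟩, add_comm (X 1 ^ m)]
    ring
  · simp only [hj.neg_one_pow, neg_mul, one_mul]
    rw [← neg_add, Odd.neg_pow ⟨i', rfl⟩, neg_sub_neg, add_comm (X 1 ^ m)]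
    ring

/-- A Dunkl operator with parameters constant on each parity class, applied to
`f = A ^ (2 * i + 1) * B ^ (2 * i' + 1)` when every difference `f - σ_j f` equals `2 * f`. -/
theorem derivation_sub_sum_exQuot (D : Derivation ℂ R2 R2) (m i i' : ℕ) (k₁ k₂ : ℂ)
    (l a : ℕ → R2) (ha : ∀ j, a j ≠ 0) (hl : ∀ j, l j = a j * D (l j)) (A B : R2)
    (hA : ∏ t ∈ Finset.range m, l (2 * t + 2) = A)
    (hB : ∏ t ∈ Finset.range m, l (2 * t + 1) = B) :
    D (A ^ (2 * i + 1) * B ^ (2 * i' + 1)) - ∑ j ∈ Finset.Icc 1 (2 * m),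
        C (if j % 2 = 1 then k₁ else k₂) *
          exQuot (a j) (2 * (A ^ (2 * i + 1) * B ^ (2 * i' + 1))) =
      A ^ (2 * i) * B ^ (2 * i') * (C (2 * i + 1 - 2 * k₂) * (D A * B) +
        C (2 * i' + 1 - 2 * k₁) * (D B * A)) := by
  have h1 := sum_exQuot_prod D (Finset.range m) (fun t => l (2 * t + 1)) (fun t => a (2 * t + 1))
    (fun _ => ha _) (fun _ => hl _) (2 * A ^ (2 * i + 1) * B ^ (2 * i'))
  have h2 := sum_exQuot_prod D (Finset.range m) (fun t => l (2 * t + 2)) (fun t => a (2 * t + 2))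
    (fun _ => ha _) (fun _ => hl _) (2 * A ^ (2 * i) * B ^ (2 * i' + 1))
  rw [hB, show B * (2 * A ^ (2 * i + 1) * B ^ (2 * i')) =
    2 * (A ^ (2 * i + 1) * B ^ (2 * i' + 1)) by ring] at h1
  rw [hA, show A * (2 * A ^ (2 * i) * B ^ (2 * i' + 1)) =
    2 * (A ^ (2 * i + 1) * B ^ (2 * i' + 1)) by ring] at h2
  rw [sum_Icc_one_two_mul]
  have e1 : ∀ t, (2 * t + 1) % 2 = 1 := by omega
  have e2 : ∀ t, ¬ (2 * t + 2) % 2 = 1 := by omega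
  simp only [e1, e2, if_true, if_false, ← Finset.mul_sum, h1, h2]
  simp only [Derivation.leibniz, Derivation.leibniz_pow, smul_eq_mul, nsmul_eq_mul,
    Nat.add_sub_cancel, map_sub, map_add, map_mul, map_natCast, map_ofNat, map_one]
  push_cast
  ring

/-- For even `d = 2m`, the polynomial `(Z^m − W^m)^{2i+1}·(Z^m + W^m)^{2i'+1}` is
singular iff `k₂ = i + 1/2` and `k₁ = i' + 1/2`. -/
theorem even_product_singular (m i i' : ℕ) (hm : 2 ≤ m) (k₁ k₂ : ℂ) (f : R2)
    (hf : f = ((X 0 : R2) ^ m - X 1 ^ m) ^ (2 * i + 1) *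
              ((X 0 : R2) ^ m + X 1 ^ m) ^ (2 * i' + 1)) :
    (DZ (2 * m) (fun j => if j % 2 = 1 then k₁ else k₂) f = 0 ∧
     DW (2 * m) (fun j => if j % 2 = 1 then k₁ else k₂) f = 0) ↔
      (k₂ = (i : ℂ) + 1 / 2 ∧ k₁ = (i' : ℂ) + 1 / 2) := by
  have hm0 : 0 < m := by omega
  subst hf
  have hc : ∀ j, zeta (2 * m) ^ j ≠ 0 := fun j => pow_ne_zero j (zeta_ne_zero _)
  have hZ := derivation_sub_sum_exQuot (pderiv 0) m i i' k₁ k₂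
    (fun j => X 0 - C (zeta (2 * m) ^ j) * X 1) (fun j => X 0 - C (zeta (2 * m) ^ j) * X 1)
    (fun j => X_zero_sub_ne_zero _) (fun j => by simp [pderiv_X]) _ _
    (prod_even_forms hm0) (prod_odd_forms hm0)
  have hW := derivation_sub_sum_exQuot (pderiv 1) m i i' k₁ k₂
    (fun j => X 0 - C (zeta (2 * m) ^ j) * X 1) (fun j => X 1 - C ((zeta (2 * m) ^ j)⁻¹) * X 0)
    (fun j => X_one_sub_ne_zero _)
    (fun j => by
      have h : (C (zeta (2 * m) ^ j) * C ((zeta (2 * m) ^ j)⁻¹) : R2) = 1 := by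
        rw [← map_mul, mul_inv_cancel₀ (hc j), map_one]
      have hD : pderiv 1 (X 0 - C (zeta (2 * m) ^ j) * X 1 : R2) = -C (zeta (2 * m) ^ j) := by
        simp [pderiv_X, -map_pow]
      rw [hD]
      linear_combination (-X 0 : R2) * h) _ _
    (prod_even_forms hm0) (prod_odd_forms hm0)
  simp only [DZ, DW, reflAct_odd_pow_mul_odd_pow hm0, sub_neg_eq_add, ← two_mul, hZ, hW]
  constructor
  · rintro ⟨h, -⟩
    have hA : (X 0 ^ m - X 1 ^ m : R2) ≠ 0 := fun h => by
      simpa [hm0.ne'] using congrArg (eval ![1, 0]) h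
    have hB : (X 0 ^ m + X 1 ^ m : R2) ≠ 0 := fun h => by
      simpa [hm0.ne'] using congrArg (eval ![1, 0]) h
    have hdA : pderiv 0 (X 0 ^ m - X 1 ^ m : R2) = (m : R2) * X 0 ^ (m - 1) := by
      simp [pderiv_X]
    have hdB : pderiv 0 (X 0 ^ m + X 1 ^ m : R2) = (m : R2) * X 0 ^ (m - 1) := by
      simp [pderiv_X]
    have hd : ((m : R2) * X 0 ^ (m - 1)) ≠ 0 :=
      mul_ne_zero (Nat.cast_ne_zero.2 hm0.ne') (pow_ne_zero _ (X_ne_zero 0))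
    have h := (mul_eq_zero.1 h).resolve_left
      (mul_ne_zero (pow_ne_zero _ hA) (pow_ne_zero _ hB))
    rw [hdA, hdB] at h
    have h' : C (2 * i + 1 - 2 * k₂) * (X 0 ^ m + X 1 ^ m : R2) +
        C (2 * i' + 1 - 2 * k₁) * (X 0 ^ m - X 1 ^ m) = 0 := by
      refine mul_left_cancel₀ hd ?_
      linear_combination h
    have hp := congrArg (eval ![1, 0]) h'
    have hq := congrArg (eval ![0, 1]) h'
    simp [hm0.ne'] at hp hq
    constructor
    · linear_combination (-1 / 4 : ℂ) * hp - (1 / 4 : ℂ) * hq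
    · linear_combination (-1 / 4 : ℂ) * hp + (1 / 4 : ℂ) * hq
  · rintro ⟨rfl, rfl⟩
    have e : ∀ n : ℕ, (2 * n + 1 - 2 * (n + 1 / 2) : ℂ) = 0 := fun n => by ring
    simp only [e, map_zero, zero_mul, add_zero, mul_zero, and_self]

end
end
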